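/- Suppose the pair (α,u) of an odd superfield α and an even superfield u solves the MRSKdV system, λ₀ ∈ ℝ, and θ₀ is an even invertible superfield solving the linear system associated with (α,u) at λ₀. Then the Darboux-transformed pair (α̂, û), where α̂ = −α − 2∂δ₀ and û = u + Dα + 2δ₀(α + ∂δ₀) with δ₀ = −(Dθ₀)θ₀⁻¹, again solves the MRSKdV system. -/

import Mathlib

noncomputable section
open scoped BigOperators

/-- The exterior algebra `Λ` of `ℝ^N`. -/
abbrev SuperAlg (N : ℕ) : Type := ExteriorAlgebra ℝ (Fin N → ℝ)

/-- The even part `Λ₀` of the exterior algebra. -/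
def LambdaEven (N : ℕ) : Submodule ℝ (SuperAlg N) :=
  CliffordAlgebra.evenOdd (0 : QuadraticForm ℝ (Fin N → ℝ)) 0

/-- The odd part `Λ₁` of the exterior algebra. -/
def LambdaOdd (N : ℕ) : Submodule ℝ (SuperAlg N) :=
  CliffordAlgebra.evenOdd (0 : QuadraticForm ℝ (Fin N → ℝ)) 1

/-- A superfield: a pair `(f₀, f₁)` of maps `ℝ² → Λ`, encoding
`f(x,t,ϑ) = f₀(x,t) + ϑ f₁(x,t)`. -/
@[ext] structure SF (N : ℕ) where
  c0 : ℝ → ℝ → SuperAlg N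
  c1 : ℝ → ℝ → SuperAlg N

namespace SF
variable {N : ℕ}

instance : Zero (SF N) := ⟨⟨0, 0⟩⟩
instance : Add (SF N) := ⟨fun f g => ⟨f.c0 + g.c0, f.c1 + g.c1⟩⟩
instance : Neg (SF N) := ⟨fun f => ⟨-f.c0, -f.c1⟩⟩
instance : Sub (SF N) := ⟨fun f g => ⟨f.c0 - g.c0, f.c1 - g.c1⟩⟩
instance : SMul ℕ (SF N) := ⟨fun n f => ⟨n • f.c0, n • f.c1⟩⟩
instance : SMul ℤ (SF N) := ⟨fun n f => ⟨n • f.c0, n • f.c1⟩⟩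
instance : SMul ℝ (SF N) := ⟨fun r f => ⟨r • f.c0, r • f.c1⟩⟩

instance : AddCommGroup (SF N) :=
  Function.Injective.addCommGroup
    (M₂ := (ℝ → ℝ → SuperAlg N) × (ℝ → ℝ → SuperAlg N))
    (fun f => (f.c0, f.c1))
    (fun a b h => by cases a; cases b; simpa using h)
    rfl (fun _ _ => rfl) (fun _ => rfl) (fun _ _ => rfl) (fun _ _ => rfl) (fun _ _ => rfl)

instance : One (SF N) := ⟨⟨fun _ _ => 1, fun _ _ => 0⟩⟩

/-- The product of superfields: `(fg)₀ = f₀g₀`,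
`(fg)₁ = f₁g₀ + σ(f₀)g₁` where `σ` is the grade involution of `Λ`
(this is the bilinear extension of the parity-sign formula for homogeneous factors). -/
instance : Mul (SF N) := ⟨fun f g =>
  ⟨fun x t => f.c0 x t * g.c0 x t,
   fun x t => f.c1 x t * g.c0 x t + CliffordAlgebra.involute (f.c0 x t) * g.c1 x t⟩⟩

/-- An even superfield. -/
def IsEven (f : SF N) : Prop :=
  (∀ x t, f.c0 x t ∈ LambdaEven N) ∧ (∀ x t, f.c1 x t ∈ LambdaOdd N)

/-- An odd superfield. -/
def IsOdd (f : SF N) : Prop :=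
  (∀ x t, f.c0 x t ∈ LambdaOdd N) ∧ (∀ x t, f.c1 x t ∈ LambdaEven N)

/-- A superfield is invertible when `f₀(x,t)` is invertible in `Λ` for all `(x,t)`. -/
def Invertible (f : SF N) : Prop := ∀ x t, IsUnit (f.c0 x t)

/-- The multiplicative inverse of a superfield (junk unless `f` is invertible). -/
def sinv (f : SF N) : SF N :=
  ⟨fun x t => Ring.inverse (f.c0 x t),
   fun x t => -(Ring.inverse (CliffordAlgebra.involute (f.c0 x t)) * f.c1 x t *
      Ring.inverse (f.c0 x t))⟩

end SF

/-- Derivative of a `Λ`-valued function of one real variable, characterized through all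
linear functionals (junk value `0` when not differentiable). -/
def derLam {N : ℕ} (g : ℝ → SuperAlg N) (x : ℝ) : SuperAlg N := by
  classical
  exact if h : ∃ d : SuperAlg N, ∀ l : SuperAlg N →ₗ[ℝ] ℝ,
      HasDerivAt (fun y => l (g y)) (l d) x
    then h.choose else 0

/-- Smoothness of a `Λ`-valued function on `ℝ²`. -/
def SmoothLam {N : ℕ} (g : ℝ → ℝ → SuperAlg N) : Prop :=
  ∀ l : SuperAlg N →ₗ[ℝ] ℝ, ContDiff ℝ (⊤ : ℕ∞) (fun p : ℝ × ℝ => l (g p.1 p.2))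

namespace SF
variable {N : ℕ}

/-- A superfield is smooth when both components are. -/
def Smooth (f : SF N) : Prop := SmoothLam f.c0 ∧ SmoothLam f.c1

/-- `∂f`, the `x`-derivative. -/
def dx (f : SF N) : SF N :=
  ⟨fun x t => derLam (fun y => f.c0 y t) x, fun x t => derLam (fun y => f.c1 y t) x⟩

/-- `∂ₜf`, the `t`-derivative. -/
def dt (f : SF N) : SF N :=
  ⟨fun x t => derLam (fun s => f.c0 x s) t, fun x t => derLam (fun s => f.c1 x s) t⟩

/-- The odd superderivative `D`, with `Df = (f₁, ∂ₓf₀)`, so `D ∘ D = ∂`. -/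
def Dsd (f : SF N) : SF N := ⟨f.c1, fun x t => derLam (fun y => f.c0 y t) x⟩

end SF

/-- `D^n`. -/
def Dpow {N : ℕ} : ℕ → SF N → SF N
  | 0, f => f
  | m + 1, f => (Dpow m f).Dsd

/-- `∂^n`. -/
def Xpow {N : ℕ} : ℕ → SF N → SF N
  | 0, f => f
  | m + 1, f => (Xpow m f).dx

/-- `f` has the parity `(−1)^m`. -/
def parityAt {N : ℕ} (f : SF N) (m : ℕ) : Prop :=
  if m % 2 = 0 then f.IsEven else f.IsOdd

/-- The Manin–Radul supersymmetric KdV system. -/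
def MRSKdV {N : ℕ} (α u : SF N) : Prop :=
  α.dt = (1/4 : ℝ) • (α.dx.dx + (3:ℝ) • (α * α.Dsd) + (6:ℝ) • (α * u)).dx ∧
  u.dt = (1/4 : ℝ) • (u.dx.dx + (3:ℝ) • (u * u) + (3:ℝ) • (α * u.Dsd)).dx

/-- The Lax operator `L = ∂² + αD + u`. -/
def Lop {N : ℕ} (α u ψ : SF N) : SF N := ψ.dx.dx + α * ψ.Dsd + u * ψ

/-- The operator `M = (1/2)α∂D + λ∂ + (1/2)u∂ − (1/4)(∂α)D − (1/4)(∂u)`. -/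
def Mop {N : ℕ} (α u : SF N) (lam : ℝ) (ψ : SF N) : SF N :=
  (1/2 : ℝ) • (α * ψ.Dsd.dx) + lam • ψ.dx + (1/2 : ℝ) • (u * ψ.dx)
    - (1/4 : ℝ) • (α.dx * ψ.Dsd) - (1/4 : ℝ) • (u.dx * ψ)

/-- The linear system `Lψ = λψ`, `∂ₜψ = Mψ` associated with `(α,u)` at `λ`. -/
def LinSys {N : ℕ} (α u : SF N) (lam : ℝ) (ψ : SF N) : Prop :=
  Lop α u ψ = lam • ψ ∧ ψ.dt = Mop α u lam ψ

/-- `δ₀ = −(Dθ₀)θ₀⁻¹`. -/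
def delta0 {N : ℕ} (θ : SF N) : SF N := -(θ.Dsd * θ.sinv)

/-- The Darboux-transformed `α̂ = −α − 2∂δ₀`. -/
def hatAlpha {N : ℕ} (α θ : SF N) : SF N := -α - (2:ℝ) • (delta0 θ).dx

/-- The Darboux-transformed `û = u + Dα + 2δ₀(α + ∂δ₀)`. -/
def hatU {N : ℕ} (α u θ : SF N) : SF N :=
  u + α.Dsd + (2:ℝ) • (delta0 θ * (α + (delta0 θ).dx))

/-- `darbIter θ m j = θ_j[m]`, the `j`-th seed after `m` Darboux steps. -/
def darbIter {N : ℕ} (θ : ℕ → SF N) : ℕ → ℕ → SF N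
  | 0, j => θ j
  | m + 1, j => (darbIter θ m j).Dsd + delta0 (darbIter θ m m) * darbIter θ m j

/-- `Titer θ n ψ = T_n ψ = (D+δ_{n−1})⋯(D+δ₀)ψ`. -/
def Titer {N : ℕ} (θ : ℕ → SF N) : ℕ → SF N → SF N
  | 0, ψ => ψ
  | m + 1, ψ => (Titer θ m ψ).Dsd + delta0 (darbIter θ m m) * Titer θ m ψ

/-- Determinant of a matrix of superfields: Leibniz formula with rows in
ascending order (for matrices of commuting, e.g. even, entries this is the usual
determinant, and when exactly one row is odd it agrees with the Laplace
expansion along that row). -/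
def detSF {N k : ℕ} (M : Matrix (Fin k) (Fin k) (SF N)) : SF N :=
  ∑ σ : Equiv.Perm (Fin k),
    ((Equiv.Perm.sign σ : ℤ)) • (((List.finRange k).map fun i => M i (σ i)).prod)

/-- Entrywise `D`-derivative of a matrix of superfields. -/
def DmatSF {N m n : ℕ} (M : Matrix (Fin m) (Fin n) (SF N)) : Matrix (Fin m) (Fin n) (SF N) :=
  Matrix.of fun i j => (M i j).Dsd

/-- The embedding `Fin (k−1) → Fin k` skipping `j`. -/
def dropIdx {k : ℕ} (j : Fin k) (i : Fin (k - 1)) : Fin k :=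
  ⟨if i.1 < j.1 then i.1 else i.1 + 1, by
    have h1 := i.2; have h2 := j.2; split <;> omega⟩

/-- The minor of `M` obtained by deleting row `j` and column `i`. -/
def minorSF {N k : ℕ} (M : Matrix (Fin k) (Fin k) (SF N)) (j i : Fin k) :
    Matrix (Fin (k-1)) (Fin (k-1)) (SF N) :=
  M.submatrix (dropIdx j) (dropIdx i)

/-- Adjugate matrix (matrix of cofactors, transposed). -/
def adjSF {N k : ℕ} (M : Matrix (Fin k) (Fin k) (SF N)) : Matrix (Fin k) (Fin k) (SF N) :=
  Matrix.of fun i j => ((-1 : ℤ) ^ (i.1 + j.1)) • detSF (minorSF M j i)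

/-- Inverse of a matrix of (even) superfields, via the adjugate
(junk unless `detSF M` is invertible). -/
def invSF {N k : ℕ} (M : Matrix (Fin k) (Fin k) (SF N)) : Matrix (Fin k) (Fin k) (SF N) :=
  Matrix.of fun i j => (detSF M).sinv * adjSF M i j

section EvenWronskian

variable {N : ℕ}

/-- `θ^{(0)} = (θ₀, θ₂, …)`. -/
def evenSeq (θ : ℕ → SF N) : ℕ → SF N := fun j => θ (2 * j)

/-- `θ^{(1)} = (θ₁, θ₃, …)`. -/
def oddSeq (θ : ℕ → SF N) : ℕ → SF N := fun j => θ (2 * j + 1)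

/-- The `k×k` Wronski matrix with rows `v, ∂v, …, ∂^{k−1}v`. -/
def Wmat (N : ℕ) (k : ℕ) (v : ℕ → SF N) : Matrix (Fin k) (Fin k) (SF N) :=
  Matrix.of fun i j => Xpow i.1 (v j.1)

/-- The Wronski matrix with last row replaced by `∂^k v`. -/
def WmatHat (N : ℕ) (k : ℕ) (v : ℕ → SF N) : Matrix (Fin k) (Fin k) (SF N) :=
  Matrix.of fun i j => if i.1 = k - 1 then Xpow k (v j.1) else Xpow i.1 (v j.1)

/-- The Wronski matrix with rows `Dv, D∂v, …, D∂^{k−2}v` and last row `∂^k v`. -/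
def WmatBarD (N : ℕ) (k : ℕ) (v : ℕ → SF N) : Matrix (Fin k) (Fin k) (SF N) :=
  Matrix.of fun i j => if i.1 = k - 1 then Xpow k (v j.1) else (Xpow i.1 (v j.1)).Dsd

/-- `W^{(0)}` (even case, `n = 2k`). -/
def W0E (N k : ℕ) (θ : ℕ → SF N) : Matrix (Fin k) (Fin k) (SF N) := Wmat N k (evenSeq θ)

/-- `W^{(1)}` (even case, `n = 2k`). -/
def W1E (N k : ℕ) (θ : ℕ → SF N) : Matrix (Fin k) (Fin k) (SF N) := Wmat N k (oddSeq θ)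

/-- The Schur complement `W^{(0)} − W^{(1)}(DW^{(1)})⁻¹DW^{(0)}`. -/
def SchurE (N k : ℕ) (θ : ℕ → SF N) : Matrix (Fin k) (Fin k) (SF N) :=
  W0E N k θ - W1E N k θ * invSF (DmatSF (W1E N k θ)) * DmatSF (W0E N k θ)

/-- The Schur complement `DW^{(1)} − (DW^{(0)})(W^{(0)})⁻¹W^{(1)}`. -/
def SchurE2 (N k : ℕ) (θ : ℕ → SF N) : Matrix (Fin k) (Fin k) (SF N) :=
  DmatSF (W1E N k θ) - DmatSF (W0E N k θ) * invSF (W0E N k θ) * W1E N k θ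

/-- `sdet 𝒲` (even case). -/
def sdetE (N k : ℕ) (θ : ℕ → SF N) : SF N :=
  detSF (SchurE N k θ) * (detSF (DmatSF (W1E N k θ))).sinv

/-- The Schur complement of the block matrix `𝒲̂` (even case). -/
def SchurEHat (N k : ℕ) (θ : ℕ → SF N) : Matrix (Fin k) (Fin k) (SF N) :=
  WmatHat N k (evenSeq θ) - WmatHat N k (oddSeq θ) * invSF (DmatSF (W1E N k θ)) * DmatSF (W0E N k θ)

/-- `sdet 𝒲̂` (even case). -/
def sdetEHat (N k : ℕ) (θ : ℕ → SF N) : SF N :=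
  detSF (SchurEHat N k θ) * (detSF (DmatSF (W1E N k θ))).sinv

end EvenWronskian

section OddWronskian

/-- `W^{(0)}`, a `(k+1)×(k+1)` matrix (odd case, `n = 2k+1`). -/
def W0O (N k : ℕ) (θ : ℕ → SF N) : Matrix (Fin (k+1)) (Fin (k+1)) (SF N) :=
  Matrix.of fun i j => Xpow i.1 (θ (2 * j.1))

/-- `W^{(1)}`, a `(k+1)×k` matrix (odd case). -/
def W1O (N k : ℕ) (θ : ℕ → SF N) : Matrix (Fin (k+1)) (Fin k) (SF N) :=
  Matrix.of fun i j => Xpow i.1 (θ (2 * j.1 + 1))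

/-- `W̃^{(0)}`: `W^{(0)}` with its last row removed. -/
def Wtil0 (N k : ℕ) (θ : ℕ → SF N) : Matrix (Fin k) (Fin (k+1)) (SF N) :=
  Matrix.of fun i j => Xpow i.1 (θ (2 * j.1))

/-- `W̃^{(1)}`: `W^{(1)}` with its last row removed. -/
def Wtil1 (N k : ℕ) (θ : ℕ → SF N) : Matrix (Fin k) (Fin k) (SF N) :=
  Matrix.of fun i j => Xpow i.1 (θ (2 * j.1 + 1))

/-- `W̌^{(0)}`: `W^{(0)}` with its second-to-last row removed. -/
def Wchk0 (N k : ℕ) (θ : ℕ → SF N) : Matrix (Fin k) (Fin (k+1)) (SF N) :=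
  Matrix.of fun i j => Xpow (if i.1 = k - 1 then k else i.1) (θ (2 * j.1))

/-- `W̌^{(1)}`: `W^{(1)}` with its second-to-last row removed. -/
def Wchk1 (N k : ℕ) (θ : ℕ → SF N) : Matrix (Fin k) (Fin k) (SF N) :=
  Matrix.of fun i j => Xpow (if i.1 = k - 1 then k else i.1) (θ (2 * j.1 + 1))

/-- `Ŵ^{(0)}`: `W^{(0)}` with last row `∂^k θ^{(0)}` replaced by `D∂^k θ^{(0)}`. -/
def W0OHat (N k : ℕ) (θ : ℕ → SF N) : Matrix (Fin (k+1)) (Fin (k+1)) (SF N) :=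
  Matrix.of fun i j => if i.1 = k then Dpow (2*k+1) (θ (2 * j.1)) else Xpow i.1 (θ (2 * j.1))

/-- `Ŵ^{(1)}`: `W^{(1)}` with last row `∂^k θ^{(1)}` replaced by `D∂^k θ^{(1)}`. -/
def W1OHat (N k : ℕ) (θ : ℕ → SF N) : Matrix (Fin (k+1)) (Fin k) (SF N) :=
  Matrix.of fun i j => if i.1 = k then Dpow (2*k+1) (θ (2 * j.1 + 1)) else Xpow i.1 (θ (2 * j.1 + 1))

/-- The Schur complement `W^{(0)} − W^{(1)}(DW̃^{(1)})⁻¹DW̃^{(0)}`. -/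
def SchurO (N k : ℕ) (θ : ℕ → SF N) : Matrix (Fin (k+1)) (Fin (k+1)) (SF N) :=
  W0O N k θ - W1O N k θ * invSF (DmatSF (Wtil1 N k θ)) * DmatSF (Wtil0 N k θ)

/-- The Schur complement `W^{(0)} − W^{(1)}(DW̌^{(1)})⁻¹DW̌^{(0)}`. -/
def SchurOchk (N k : ℕ) (θ : ℕ → SF N) : Matrix (Fin (k+1)) (Fin (k+1)) (SF N) :=
  W0O N k θ - W1O N k θ * invSF (DmatSF (Wchk1 N k θ)) * DmatSF (Wchk0 N k θ)

/-- The Schur complement `Ŵ^{(0)} − Ŵ^{(1)}(DW̃^{(1)})⁻¹DW̃^{(0)}`. -/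
def SchurOHat (N k : ℕ) (θ : ℕ → SF N) : Matrix (Fin (k+1)) (Fin (k+1)) (SF N) :=
  W0OHat N k θ - W1OHat N k θ * invSF (DmatSF (Wtil1 N k θ)) * DmatSF (Wtil0 N k θ)

/-- `sdet 𝒲` (odd case). -/
def sdetO (N k : ℕ) (θ : ℕ → SF N) : SF N :=
  detSF (SchurO N k θ) * (detSF (DmatSF (Wtil1 N k θ))).sinv

/-- `sdet 𝒲̌` (odd case). -/
def sdetOchk (N k : ℕ) (θ : ℕ → SF N) : SF N :=
  detSF (SchurOchk N k θ) * (detSF (DmatSF (Wchk1 N k θ))).sinv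

/-- The quotient `det(Ŵ^{(0)} − Ŵ^{(1)}(DW̃^{(1)})⁻¹DW̃^{(0)}) / det(W^{(0)} − W^{(1)}(DW̃^{(1)})⁻¹DW̃^{(0)})`. -/
def Qodd (N k : ℕ) (θ : ℕ → SF N) : SF N :=
  detSF (SchurOHat N k θ) * (detSF (SchurO N k θ)).sinv

end OddWronskian


set_option linter.unusedSimpArgs false
set_option maxHeartbeats 2000000
theorem core {S R : Type*} [CommRing S] [Ring R] [Algebra S R] [Algebra ℝ S] [Algebra ℝ R]
  [IsScalarTower ℝ S R] (D X T : R →ₗ[ℝ] R) (d al : ℕ → R) (p a : ℕ → S) (lam : ℝ) (u m α' u' : R)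
  (Xmul : ∀ x y, X (x*y) = X x * y + x * X y)
  (Tmul : ∀ x y, T (x*y) = T x * y + x * T y)
  (Xp : ∀ n y, X (p n • y) = p (n+1) • y + p n • X y)
  (Xa : ∀ n y, X (a n • y) = a (n+1) • y + a n • X y)
  (Xd : ∀ n, X (d n) = d (n+1)) (Xal : ∀ n, X (al n) = al (n+1)) (X1 : X 1 = 0) (D1 : D 1 = 0)
  (T1 : T 1 = 0)
  (Dd : ∀ n y, D (d n * y) = p n • y - d n * D y)
  (Dal : ∀ n y, D (al n * y) = a n • y - al n * D y)
  (Dd' : ∀ n, D (d n) = p n • 1)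
  (Dal' : ∀ n, D (al n) = a n • 1)
  (Dp : ∀ n y, D (p n • y) = d (n+1) * y + p n • D y)
  (Da : ∀ n y, D (a n • y) = al (n+1) * y + a n • D y)
  (TX : ∀ y, T (X y) = X (T y)) (TD : ∀ y, T (D y) = D (T y))
  (dd : ∀ i, d i * d i = 0) (aa : ∀ i, al i * al i = 0)
  (ddc : ∀ i j, j < i → d i * d j = - (d j * d i))
  (aac : ∀ i j, j < i → al i * al j = - (al j * al i))
  (adc : ∀ i j, al i * d j = - (d j * al i))
  (hu : u = lam • (1:R) + p 1 • (1:R) - p 0 • p 0 • (1:R) + al 0 * d 0)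
  (hm : m = (1/2:ℝ) • (al 0 * (- d 1 + p 0 • d 0)) - lam • p 0 • (1:R) - (1/2:ℝ) • p 0 • u
    + (1/4:ℝ) • (al 1 * d 0) - (1/4:ℝ) • X u)
  (hTd : T (d 0) = - D m)
  (hTa : T (al 0) = (1/4:ℝ) • X (X (X (al 0)) + (3:ℝ) • (al 0 * D (al 0)) + (6:ℝ) • (al 0 * u)))
  (hα' : α' = - al 0 - (2:ℝ) • X (d 0))
  (hu' : u' = u + D (al 0) + (2:ℝ) • (d 0 * (al 0 + X (d 0)))) :
   T α' = (1/4 : ℝ) • X (X (X α') + (3:ℝ) • (α' * D α') + (6:ℝ) • (α' * u')) ∧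
   T u' = (1/4 : ℝ) • X (X (X u') + (3:ℝ) • (u' * u') + (3:ℝ) • (α' * D u')) := by
  have dd' : ∀ i y, d i * (d i * y) = 0 := fun i y => by rw [← mul_assoc, dd, zero_mul]
  have aa' : ∀ i y, al i * (al i * y) = 0 := fun i y => by rw [← mul_assoc, aa, zero_mul]
  have ddc' : ∀ i j y, j < i → d i * (d j * y) = - (d j * (d i * y)) := fun i j y h => by
    rw [← mul_assoc, ddc i j h, neg_mul, mul_assoc]
  have aac' : ∀ i j y, j < i → al i * (al j * y) = - (al j * (al i * y)) := fun i j y h => by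
    rw [← mul_assoc, aac i j h, neg_mul, mul_assoc]
  have adc' : ∀ i j y, al i * (d j * y) = - (d j * (al i * y)) := fun i j y => by
    rw [← mul_assoc, adc i j, neg_mul, mul_assoc]
  have Tp : ∀ s : S, ∀ y, T (s • y) = T (s • 1) * y + s • T y := fun s y => by
    have := Tmul (s • 1) y
    simpa using this
  have Td1 : T (d 1) = X (T (d 0)) := by rw [← TX, Xd]
  have Tp0 : T (p 0 • 1) = D (T (d 0)) := by rw [← TD, Dd']
  have Tp1 : T (p 1 • 1) = D (X (T (d 0))) := by rw [← TX, ← TD, Xd, Dd']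
  have Ta0 : T (a 0 • 1) = D (T (al 0)) := by rw [← TD, Dal']
  have hc : ∀ r : ℝ, (Algebra.cast r : S) = algebraMap ℝ S r := fun _ => rfl
  have hm' : m = (1/4:ℝ) • ((2:ℝ) • (al 0 * (- d 1 + p 0 • d 0)) - (4:ℝ) • lam • p 0 • (1:R)
    - (2:ℝ) • p 0 • u + al 1 * d 0 - X u) := by
    rw [hm, show (1/2:ℝ) = (1/4:ℝ) * 2 by norm_num, mul_smul, mul_smul, ← sub_eq_zero]
    simp only [smul_add, smul_sub, smul_smul]
    norm_num
    rw [show (1/4 * (4 * lam) : ℝ) = lam by ring, sub_self]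
  clear hm
  subst hm' hα' hu'
  subst hu
  constructor
  · simp only [map_zero, map_add, map_sub, map_neg, map_smul, Xd, Xal, Dd', Dal', Td1, hTd, hTa]
    simp only [map_zero, map_add, map_sub, map_neg, map_smul, Xmul, Xp, Xa, Xd, Xal, X1, D1, Dd, Dal, Dd', Dal',
      Dp, Da, mul_add, add_mul, mul_sub, sub_mul, smul_mul_assoc, mul_smul_comm, mul_neg, neg_mul, mul_one, one_mul,
      mul_zero, smul_zero, add_zero, zero_add, sub_zero, neg_neg, mul_assoc, smul_add, smul_sub, smul_neg, Nat.reduceAdd]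
    simp only [dd, aa, dd', aa', ddc, aac, ddc', aac', adc, adc', Nat.reduceLT, mul_neg, smul_neg, neg_neg, smul_zero,
      add_zero, zero_add, mul_zero, sub_zero]
    match_scalars <;> simp only [hc, map_ofNat] <;> ring
  · have key : T (p 0 • p 0 • (1:R)) = (2:ℝ) • p 0 • T (p 0 • 1) := by
      have h : T (p 0 • p 0 • (1:R)) = T (p 0 • 1) * (p 0 • 1) + p 0 • T (p 0 • 1) := Tp _ _
      rw [h, mul_smul_comm, mul_one, two_smul]
    have keyl : T (lam • (1:R)) = 0 := by rw [map_smul, T1, smul_zero]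
    rw [map_add T, map_add T, map_add T, map_sub T, map_add T, keyl, key, Tp1, Tp0, Dal', Ta0, map_smul T,
      Tmul, Tmul, map_add T, Xd, Td1, hTd, hTa]
    simp only [map_zero, map_add, map_sub, map_neg, map_smul, Xmul, Xp, Xa, Xd, Xal, X1, D1, Dd, Dal, Dd', Dal',
      Dp, Da, mul_add, add_mul, mul_sub, sub_mul, smul_mul_assoc, mul_smul_comm, mul_neg, neg_mul, mul_one, one_mul,
      mul_zero, smul_zero, add_zero, zero_add, sub_zero, neg_neg, mul_assoc, smul_add, smul_sub, smul_neg, Nat.reduceAdd]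
    simp only [dd, aa, dd', aa', ddc, aac, ddc', aac', adc, adc', Nat.reduceLT, mul_neg, smul_neg, neg_neg, smul_zero,
      add_zero, zero_add, mul_zero, sub_zero]
    match_scalars <;> simp only [hc, map_ofNat] <;> ring

/-- The center of `R`, as a bare type. -/
def Cen (R : Type*) [Ring R] [Algebra ℝ R] : Type _ := Subalgebra.center ℝ R

instance {R : Type*} [Ring R] [Algebra ℝ R] : CommRing (Cen R) :=
  inferInstanceAs (CommRing (Subalgebra.center ℝ R))

instance {R : Type*} [Ring R] [Algebra ℝ R] : Algebra ℝ (Cen R) :=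
  inferInstanceAs (Algebra ℝ (Subalgebra.center ℝ R))

instance {R : Type*} [Ring R] [Algebra ℝ R] : Algebra (Cen R) R :=
  RingHom.toAlgebra' (Subalgebra.center ℝ R).val.toRingHom
    (fun c x => (Subalgebra.mem_center_iff.1 c.2 x).symm)

theorem cen_smul {R : Type*} [Ring R] [Algebra ℝ R] (c : Cen R) (y : R) : c • y = c.1 * y := rfl

/-- Central elements. -/
def Cen.mk {R : Type*} [Ring R] [Algebra ℝ R] (x : R) (h : x ∈ Subalgebra.center ℝ R) : Cen R := ⟨x, h⟩

theorem cen_mk_smul {R : Type*} [Ring R] [Algebra ℝ R] (x : R) (h : x ∈ Subalgebra.center ℝ R) (y : R) :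
    Cen.mk x h • y = x * y := rfl

instance {R : Type*} [Ring R] [Algebra ℝ R] : IsScalarTower ℝ (Cen R) R :=
  ⟨fun r c y => by
    rw [cen_smul, cen_smul, ← smul_mul_assoc]; rfl⟩

theorem core2 {R : Type*} [Ring R] [Algebra ℝ R] (D T : R →ₗ[ℝ] R) (σ : R →ₐ[ℝ] R)
  (σσ : ∀ y, σ (σ y) = y) (σD : ∀ y, σ (D y) = - D (σ y)) (σT : ∀ y, σ (T y) = T (σ y))
  (Dmul : ∀ x y, D (x * y) = D x * y + σ x * D y)
  (Tmul : ∀ x y, T (x * y) = T x * y + x * T y) (TD : ∀ y, T (D y) = D (T y))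
  (ev : ∀ x, σ x = x → ∀ y, x * y = y * x)
  (od : ∀ x y, σ x = - x → σ y = - y → x * y = - (y * x))
  (α u θ ι δ : R) (lam : ℝ) (hα : σ α = - α) (hθ : σ θ = θ) (hι : θ * ι = 1)
  (hδ : δ = - (D θ * ι))
  (hMR : T α = (1/4:ℝ) • D (D (D (D (D (D α))) + (3:ℝ) • (α * D α) + (6:ℝ) • (α * u))))
  (hL : D (D (D (D θ))) + α * D θ + u * θ = lam • θ)
  (hM : T θ = (1/2 : ℝ) • (α * D (D (D θ))) + lam • D (D θ) + (1/2 : ℝ) • (u * D (D θ))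
    - (1/4 : ℝ) • (D (D α) * D θ) - (1/4 : ℝ) • (D (D u) * θ)) :
  ∀ α' u', α' = - α - (2:ℝ) • D (D δ) → u' = u + D α + (2:ℝ) • (δ * (α + D (D δ))) →
   T α' = (1/4 : ℝ) • D (D (D (D (D (D α'))) + (3:ℝ) • (α' * D α') + (6:ℝ) • (α' * u'))) ∧
   T u' = (1/4 : ℝ) • D (D (D (D (D (D u'))) + (3:ℝ) • (u' * u') + (3:ℝ) • (α' * D u'))) := by
  intro α' u' hα' hu'
  have D1 : D 1 = 0 := by have := Dmul 1 1; simpa using this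
  have T1 : T 1 = 0 := by have := Tmul 1 1; simpa using this
  have hι' : ι * θ = 1 := by rw [← ev θ hθ, hι]
  have can : ∀ x y, x * θ = y * θ → x = y := fun x y h => by
    have := congrArg (· * ι) h
    simpa [mul_assoc, hι] using this
  have σι : σ ι = ι := by
    apply can; rw [hι', ← hθ, ← map_mul, hι', map_one]
  have σδ : σ δ = - δ := by rw [hδ]; simp [σD, hθ, σι]
  have Xmul : ∀ x y, (D ∘ₗ D) (x * y) = (D ∘ₗ D) x * y + x * (D ∘ₗ D) y := fun x y => by
    simp [Dmul, σD, σσ]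
  have σX : ∀ y, σ ((D ∘ₗ D) y) = (D ∘ₗ D) (σ y) := fun y => by simp [σD]
  obtain ⟨X, hX⟩ : ∃ X : R →ₗ[ℝ] R, X = D ∘ₗ D := ⟨_, rfl⟩
  have hXD : ∀ y, D (D y) = X y := fun y => by rw [hX]; rfl
  rw [← hX] at Xmul σX
  simp only [hXD] at hMR hL hM hα' hu' ⊢
  have XD : ∀ y, D (X y) = X (D y) := fun y => by rw [hX]; rfl
  have Dθ : D θ = - (δ * θ) := by rw [hδ]; simp [mul_assoc, hι']
  have dd0 : ∀ x, σ x = - x → x * x = 0 := fun x h => by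
    have h1 := od x x h h
    have h2 : (2:ℝ) • (x * x) = 0 := by rw [two_smul]; nth_rewrite 1 [h1]; simp
    simpa using h2
  have σDo : ∀ x, σ x = - x → σ (D x) = D x := fun x h => by rw [σD, h]; simp
  have Xθ : X θ = - (D δ * θ) := by
    rw [← hXD, Dθ, map_neg, Dmul, σδ, Dθ]
    simp [← mul_assoc, dd0 δ σδ]
  have XXθ : X (X θ) = (- X (D δ) + D δ * D δ) * θ := by
    rw [Xθ, map_neg, Xmul, Xθ]; noncomm_ring
  have hu : u = lam • (1:R) + X (D δ) - D δ * D δ + α * δ := by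
    apply can
    rw [XXθ, Dθ] at hL
    have : u * θ = lam • θ - (-X (D δ) + D δ * D δ) * θ + α * δ * θ := by
      rw [← hL]; noncomm_ring
    rw [this]; simp only [add_mul, sub_mul, neg_mul, smul_mul_assoc, one_mul]; abel
  obtain ⟨m, hmdef⟩ : ∃ m, m = T θ * ι := ⟨_, rfl⟩
  have hmθ : m * θ = T θ := by rw [hmdef, mul_assoc, hι', mul_one]
  have σm : σ m = m := by rw [hmdef, map_mul, σT, hθ, σι]
  have XDθ : D (X θ) = (- X δ + D δ * δ) * θ := by
    rw [Xθ, map_neg, Dmul, σDo δ σδ, Dθ, hXD]; noncomm_ring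
  have hm : m = (1/2:ℝ) • (α * (- X δ + D δ * δ)) - lam • D δ - (1/2:ℝ) • (D δ * u)
    + (1/4:ℝ) • (X α * δ) - (1/4:ℝ) • X u := by
    apply can
    rw [hmθ, hM, XDθ, Xθ, Dθ, ev (D δ) (σDo δ σδ) u]
    simp only [add_mul, sub_mul, mul_add, mul_neg, neg_mul, smul_mul_assoc, mul_assoc, smul_neg]
    abel
  have hTδ : T δ = - D m := by
    apply can
    have h1 := TD θ
    rw [Dθ, ← hmθ, Dmul, σm, Dθ, map_neg, Tmul, ← hmθ] at h1
    have h2 : δ * (m * θ) = m * (δ * θ) := by rw [← mul_assoc, ← ev m σm, mul_assoc]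
    rw [h2] at h1
    have h3 : T δ * θ = - (D m * θ + m * -(δ * θ)) - m * (δ * θ) := by rw [← h1]; abel
    rw [h3]; noncomm_ring
  have σd : ∀ x, σ x = - x → ∀ n : ℕ, σ ((X ^ n) x) = - (X ^ n) x := fun x hx n => by
    induction n with
    | zero => simpa using hx
    | succ n ih => rw [pow_succ', Module.End.mul_apply, σX, ih, map_neg]
  have cen : ∀ x, σ x = - x → ∀ n : ℕ, D ((X ^ n) x) ∈ Subalgebra.center ℝ R := fun x hx n =>
    Subalgebra.mem_center_iff.2 fun y => (ev _ (σDo _ (σd x hx n)) y).symm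
  have Xs : ∀ x (n : ℕ), X ((X ^ n) x) = (X ^ (n+1)) x := fun x n => by
    rw [pow_succ', Module.End.mul_apply]
  have TX : ∀ y, T (X y) = X (T y) := fun y => by rw [← hXD, TD, TD, hXD]
  have X1 : X 1 = 0 := by rw [← hXD, D1, map_zero]
  refine core (S := Cen R) D X T (fun n => (X ^ n) δ) (fun n => (X ^ n) α)
    (fun n => Cen.mk (D ((X ^ n) δ)) (cen δ σδ n)) (fun n => Cen.mk (D ((X ^ n) α)) (cen α hα n)) lam u m α' u'
    Xmul Tmul ?_ ?_ (fun n => Xs _ n) (fun n => Xs _ n) X1 D1 T1 ?_ ?_ ?_ ?_ ?_ ?_ TX TD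
    (fun i => dd0 _ (σd δ σδ i)) (fun i => dd0 _ (σd α hα i))
    (fun i j _ => od _ _ (σd δ σδ i) (σd δ σδ j)) (fun i j _ => od _ _ (σd α hα i) (σd α hα j))
    (fun i j => od _ _ (σd α hα i) (σd δ σδ j)) ?_ ?_ ?_ ?_ ?_ ?_
  · intro n y; simp only [cen_mk_smul]; rw [Xmul, ← XD, Xs]
  · intro n y; simp only [cen_mk_smul]; rw [Xmul, ← XD, Xs]
  · intro n y; simp only [cen_mk_smul]; rw [Dmul, σd δ σδ]; noncomm_ring
  · intro n y; simp only [cen_mk_smul]; rw [Dmul, σd α hα]; noncomm_ring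
  · intro n; simp only [cen_mk_smul, mul_one]
  · intro n; simp only [cen_mk_smul, mul_one]
  · intro n y; simp only [cen_mk_smul]; rw [Dmul, σDo _ (σd δ σδ n), hXD, Xs]
  · intro n y; simp only [cen_mk_smul]; rw [Dmul, σDo _ (σd α hα n), hXD, Xs]
  · simp only [cen_mk_smul, mul_one, pow_one, pow_zero, Module.End.one_apply, hu, XD]
  · simp only [cen_mk_smul, mul_one, pow_one, pow_zero, Module.End.one_apply, hm]
  · simpa using hTδ
  · simpa using hMR
  · simpa using hα'
  · simpa using hu'

section Analysis
variable {N : ℕ}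

def bas (N : ℕ) : Module.Basis (Finset (Fin N)) ℝ (SuperAlg N) :=
  (Pi.basisFun ℝ (Fin N)).ExteriorAlgebra

def HasDL (g : ℝ → SuperAlg N) (d : SuperAlg N) (x : ℝ) : Prop :=
  ∀ l : SuperAlg N →ₗ[ℝ] ℝ, HasDerivAt (fun y => l (g y)) (l d) x

theorem HasDL.derLam_eq {g : ℝ → SuperAlg N} {d : SuperAlg N} {x : ℝ} (h : HasDL g d x) :
    derLam g x = d := by
  have hex : ∃ d : SuperAlg N, ∀ l : SuperAlg N →ₗ[ℝ] ℝ,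
      HasDerivAt (fun y => l (g y)) (l d) x := ⟨d, h⟩
  have h1 : derLam g x = hex.choose := by
    unfold derLam; exact dif_pos hex
  rw [h1]
  apply (bas N).ext_elem
  intro i
  exact (hex.choose_spec ((bas N).coord i)).unique (h ((bas N).coord i))

theorem fun_expand (l : SuperAlg N →ₗ[ℝ] ℝ) (v : SuperAlg N) :
    l v = ∑ i, (bas N).coord i v * l (bas N i) := by
  conv_lhs => rw [← (bas N).sum_repr v]
  rw [map_sum]
  exact Finset.sum_congr rfl fun i _ => by rw [map_smul]; rfl

theorem mul_expand (l : SuperAlg N →ₗ[ℝ] ℝ) (v w : SuperAlg N) :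
    l (v * w) = ∑ i, ∑ j, (bas N).coord i v * ((bas N).coord j w * l (bas N i * bas N j)) := by
  have h1 := fun_expand (l ∘ₗ LinearMap.mulRight ℝ w) v
  simp only [LinearMap.comp_apply, LinearMap.mulRight_apply] at h1
  rw [h1]
  refine Finset.sum_congr rfl fun i _ => ?_
  have h2 := fun_expand (l ∘ₗ LinearMap.mulLeft ℝ (bas N i)) w
  simp only [LinearMap.comp_apply, LinearMap.mulLeft_apply] at h2
  rw [h2, Finset.mul_sum]

theorem hasDL_of_coord {g : ℝ → SuperAlg N} {x : ℝ}
    (h : ∀ i, DifferentiableAt ℝ (fun y => (bas N).coord i (g y)) x) : HasDL g (derLam g x) x := by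
  have : HasDL g (∑ i, deriv (fun y => (bas N).coord i (g y)) x • bas N i) x := by
    intro l
    have h2 : HasDerivAt (fun y => ∑ i, (bas N).coord i (g y) * l (bas N i))
        (∑ i, deriv (fun y => (bas N).coord i (g y)) x * l (bas N i)) x :=
      HasDerivAt.fun_sum fun i _ => (h i).hasDerivAt.mul_const _
    simp only [← fun_expand] at h2
    simpa using h2
  rw [this.derLam_eq]; exact this

theorem HasDL.mul {f g : ℝ → SuperAlg N} {f' g' : SuperAlg N} {x : ℝ} (hf : HasDL f f' x)
    (hg : HasDL g g' x) : HasDL (fun y => f y * g y) (f' * g x + f x * g') x := by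
  intro l
  have he : (fun y => l (f y * g y)) = fun y => ∑ i, ∑ j, (bas N).coord i (f y) *
      ((bas N).coord j (g y) * l (bas N i * bas N j)) := funext fun y => mul_expand l _ _
  rw [he, map_add, mul_expand l f', mul_expand l (f x), ← Finset.sum_add_distrib]
  refine HasDerivAt.fun_sum fun i _ => ?_
  rw [← Finset.sum_add_distrib]
  refine HasDerivAt.fun_sum fun j _ => ?_
  exact (hf ((bas N).coord i)).mul ((hg ((bas N).coord j)).mul_const _)

theorem HasDL.add {f g : ℝ → SuperAlg N} {f' g' : SuperAlg N} {x : ℝ} (hf : HasDL f f' x)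
    (hg : HasDL g g' x) : HasDL (fun y => f y + g y) (f' + g') x := by
  intro l; simp only [map_add]; exact (hf l).add (hg l)

theorem HasDL.map {f : ℝ → SuperAlg N} {f' : SuperAlg N} {x : ℝ} (hf : HasDL f f' x)
    (φ : SuperAlg N →ₗ[ℝ] SuperAlg N) : HasDL (fun y => φ (f y)) (φ f') x :=
  fun l => hf (l ∘ₗ φ)

abbrev LF (N : ℕ) := ℝ → ℝ → SuperAlg N

def dX (g : LF N) : LF N := fun x t => derLam (fun y => g y t) x
def dT (g : LF N) : LF N := fun x t => derLam (fun s => g x s) t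

theorem SmoothLam.hasDerivAt_left {g : LF N} (hg : SmoothLam g) (l : SuperAlg N →ₗ[ℝ] ℝ) (x t : ℝ) :
    HasDerivAt (fun y => l (g y t))
      (fderiv ℝ (fun p : ℝ × ℝ => l (g p.1 p.2)) (x, t) (1, 0)) x := by
  have h := ((hg l).differentiable (by simp) (x, t)).hasFDerivAt
  exact h.comp_hasDerivAt (f := fun y : ℝ => (y, t)) x ((hasDerivAt_id x).prodMk (hasDerivAt_const x t))

theorem SmoothLam.hasDerivAt_right {g : LF N} (hg : SmoothLam g) (l : SuperAlg N →ₗ[ℝ] ℝ) (x t : ℝ) :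
    HasDerivAt (fun s => l (g x s))
      (fderiv ℝ (fun p : ℝ × ℝ => l (g p.1 p.2)) (x, t) (0, 1)) t := by
  have h := ((hg l).differentiable (by simp) (x, t)).hasFDerivAt
  exact h.comp_hasDerivAt (f := fun s : ℝ => (x, s)) t ((hasDerivAt_const t x).prodMk (hasDerivAt_id t))

theorem SmoothLam.hX {g : LF N} (hg : SmoothLam g) (x t : ℝ) :
    HasDL (fun y => g y t) (dX g x t) x :=
  hasDL_of_coord fun i => (hg.hasDerivAt_left _ x t).differentiableAt

theorem SmoothLam.hT {g : LF N} (hg : SmoothLam g) (x t : ℝ) :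
    HasDL (fun s => g x s) (dT g x t) t :=
  hasDL_of_coord fun i => (hg.hasDerivAt_right _ x t).differentiableAt

theorem SmoothLam.l_dX {g : LF N} (hg : SmoothLam g) (l : SuperAlg N →ₗ[ℝ] ℝ) :
    (fun p : ℝ × ℝ => l (dX g p.1 p.2)) =
      fun p => fderiv ℝ (fun p : ℝ × ℝ => l (g p.1 p.2)) p (1, 0) :=
  funext fun p => (hg.hX p.1 p.2 l).unique (hg.hasDerivAt_left l p.1 p.2)

theorem SmoothLam.l_dT {g : LF N} (hg : SmoothLam g) (l : SuperAlg N →ₗ[ℝ] ℝ) :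
    (fun p : ℝ × ℝ => l (dT g p.1 p.2)) =
      fun p => fderiv ℝ (fun p : ℝ × ℝ => l (g p.1 p.2)) p (0, 1) :=
  funext fun p => (hg.hT p.1 p.2 l).unique (hg.hasDerivAt_right l p.1 p.2)

theorem SmoothLam.dX {g : LF N} (hg : SmoothLam g) : SmoothLam (dX g) := fun l => by
  rw [hg.l_dX]
  exact ((hg l).fderiv_right (m := (⊤ : ℕ∞)) (by simp)).clm_apply contDiff_const

theorem SmoothLam.dT {g : LF N} (hg : SmoothLam g) : SmoothLam (dT g) := fun l => by
  rw [hg.l_dT]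
  exact ((hg l).fderiv_right (m := (⊤ : ℕ∞)) (by simp)).clm_apply contDiff_const

theorem fderiv_swap (F : ℝ × ℝ → ℝ) (hF : ContDiff ℝ (⊤ : ℕ∞) F) (v w p : ℝ × ℝ) :
    fderiv ℝ (fun q => fderiv ℝ F q v) p w = fderiv ℝ (fun q => fderiv ℝ F q w) p v := by
  have hd : DifferentiableAt ℝ (fderiv ℝ F) p :=
    (hF.fderiv_right (m := (⊤ : ℕ∞)) (by simp)).differentiable (by simp) p
  have hs : IsSymmSndFDerivAt ℝ F p := hF.contDiffAt.isSymmSndFDerivAt (by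
    rw [minSmoothness_of_isRCLikeNormedField]; exact WithTop.coe_le_coe.2 (le_top : (2:ℕ∞) ≤ ⊤))
  rw [fderiv_clm_apply hd (by fun_prop), fderiv_clm_apply hd (by fun_prop)]
  simpa using hs w v

theorem SmoothLam.comm {g : LF N} (hg : SmoothLam g) : _root_.dT (_root_.dX g) = _root_.dX (_root_.dT g) := by
  funext x t
  apply (bas N).ext_elem
  intro i
  have h1 := congrFun (hg.dX.l_dT ((bas N).coord i)) (x, t)
  have h2 := congrFun (hg.dT.l_dX ((bas N).coord i)) (x, t)
  rw [hg.l_dX] at h1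
  rw [hg.l_dT] at h2
  exact h1.trans ((fderiv_swap _ (hg _) _ _ _).trans h2.symm)

theorem SmoothLam.add {f g : LF N} (hf : SmoothLam f) (hg : SmoothLam g) :
    SmoothLam (fun x t => f x t + g x t) := fun l => by
  simp only [map_add]; exact (hf l).add (hg l)

theorem SmoothLam.map {f : LF N} (hf : SmoothLam f) (φ : SuperAlg N →ₗ[ℝ] SuperAlg N) :
    SmoothLam (fun x t => φ (f x t)) := fun l => hf (l ∘ₗ φ)

theorem SmoothLam.const (c : SuperAlg N) : SmoothLam (fun _ _ => c) := fun _ => contDiff_const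

theorem SmoothLam.mul {f g : LF N} (hf : SmoothLam f) (hg : SmoothLam g) :
    SmoothLam (fun x t => f x t * g x t) := fun l => by
  have he : (fun p : ℝ × ℝ => l (f p.1 p.2 * g p.1 p.2)) = fun p => ∑ i, ∑ j,
      (bas N).coord i (f p.1 p.2) * ((bas N).coord j (g p.1 p.2) * l (bas N i * bas N j)) :=
    funext fun y => mul_expand l _ _
  rw [he]
  exact ContDiff.sum fun i _ => ContDiff.sum fun j _ => (hf _).mul ((hg _).mul contDiff_const)

theorem dX_add {f g : LF N} (hf : SmoothLam f) (hg : SmoothLam g) :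
    dX (fun x t => f x t + g x t) = fun x t => dX f x t + dX g x t :=
  funext fun x => funext fun t => ((hf.hX x t).add (hg.hX x t)).derLam_eq

theorem dT_add {f g : LF N} (hf : SmoothLam f) (hg : SmoothLam g) :
    dT (fun x t => f x t + g x t) = fun x t => dT f x t + dT g x t :=
  funext fun x => funext fun t => ((hf.hT x t).add (hg.hT x t)).derLam_eq

theorem dX_map {f : LF N} (hf : SmoothLam f) (φ : SuperAlg N →ₗ[ℝ] SuperAlg N) :
    dX (fun x t => φ (f x t)) = fun x t => φ (dX f x t) :=
  funext fun x => funext fun t => ((hf.hX x t).map φ).derLam_eq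

theorem dT_map {f : LF N} (hf : SmoothLam f) (φ : SuperAlg N →ₗ[ℝ] SuperAlg N) :
    dT (fun x t => φ (f x t)) = fun x t => φ (dT f x t) :=
  funext fun x => funext fun t => ((hf.hT x t).map φ).derLam_eq

theorem dX_mul {f g : LF N} (hf : SmoothLam f) (hg : SmoothLam g) :
    dX (fun x t => f x t * g x t) = fun x t => dX f x t * g x t + f x t * dX g x t :=
  funext fun x => funext fun t => ((hf.hX x t).mul (hg.hX x t)).derLam_eq

theorem dT_mul {f g : LF N} (hf : SmoothLam f) (hg : SmoothLam g) :
    dT (fun x t => f x t * g x t) = fun x t => dT f x t * g x t + f x t * dT g x t :=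
  funext fun x => funext fun t => ((hf.hT x t).mul (hg.hT x t)).derLam_eq

open CliffordAlgebra in
theorem lam_super {i j : ZMod 2} {x y : SuperAlg N}
    (hx : x ∈ evenOdd (0 : QuadraticForm ℝ (Fin N → ℝ)) i)
    (hy : y ∈ evenOdd (0 : QuadraticForm ℝ (Fin N → ℝ)) j) :
    x * y = (-1 : ℤˣ) ^ (j * i) • (y * x) := by
  have := map_mul_map_of_isOrtho_of_mem_evenOdd (QuadraticMap.Isometry.id (0 : QuadraticForm ℝ (Fin N → ℝ)))
    (QuadraticMap.Isometry.id (0 : QuadraticForm ℝ (Fin N → ℝ))) (by intro x y; simp [QuadraticMap.IsOrtho]) x y hx hy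
  simpa using this

theorem lam_decomp (x : SuperAlg N) : ∃ x0 ∈ LambdaEven N, ∃ x1 ∈ LambdaOdd N, x = x0 + x1 := by
  have h := (CliffordAlgebra.evenOdd_isCompl (0 : QuadraticForm ℝ (Fin N → ℝ))).sup_eq_top
  have hx : x ∈ CliffordAlgebra.evenOdd (0 : QuadraticForm ℝ (Fin N → ℝ)) 0 ⊔
    CliffordAlgebra.evenOdd (0 : QuadraticForm ℝ (Fin N → ℝ)) 1 := by rw [h]; trivial
  obtain ⟨a, ha, b, hb, hab⟩ := Submodule.mem_sup.1 hx
  exact ⟨a, ha, b, hb, hab.symm⟩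

/-- grade involution -/
def inv (x : SuperAlg N) : SuperAlg N :=
  CliffordAlgebra.involute (Q := (0 : QuadraticForm ℝ (Fin N → ℝ))) x

theorem inv_even {x : SuperAlg N} (h : x ∈ LambdaEven N) : inv x = x :=
  CliffordAlgebra.involute_eq_of_mem_even h
theorem inv_odd {x : SuperAlg N} (h : x ∈ LambdaOdd N) : inv x = -x :=
  CliffordAlgebra.involute_eq_of_mem_odd h

theorem two_cancel {x : SuperAlg N} (h : x = - x) : x = 0 := by
  have h2 : (2:ℝ) • x = 0 := by rw [two_smul]; nth_rewrite 1 [h]; simp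
  simpa using h2

theorem mem_even {x : SuperAlg N} (h : inv x = x) : x ∈ LambdaEven N := by
  obtain ⟨a, ha, b, hb, rfl⟩ := lam_decomp x
  have h1 : inv (a + b) = a + -b := by
    rw [← inv_odd hb]; nth_rewrite 2 [← inv_even ha]; exact map_add _ _ _
  rw [h1] at h
  have : b = 0 := two_cancel (add_left_cancel h).symm
  rwa [this, add_zero]

theorem mem_odd {x : SuperAlg N} (h : inv x = -x) : x ∈ LambdaOdd N := by
  obtain ⟨a, ha, b, hb, rfl⟩ := lam_decomp x
  have h1 : inv (a + b) = a + -b := by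
    rw [← inv_odd hb]; nth_rewrite 2 [← inv_even ha]; exact map_add _ _ _
  rw [h1, neg_add] at h
  have : a = 0 := two_cancel (add_right_cancel h)
  rwa [this, zero_add]

theorem even_comm {x : SuperAlg N} (h : inv x = x) (y : SuperAlg N) : x * y = y * x := by
  obtain ⟨a, ha, b, hb, rfl⟩ := lam_decomp y
  have h1 := lam_super (mem_even h) ha
  have h2 := lam_super (mem_even h) hb
  simp at h1 h2
  rw [mul_add, add_mul, h1, h2]

theorem odd_comm {x : SuperAlg N} (h : inv x = -x) (y : SuperAlg N) : x * y = inv y * x := by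
  obtain ⟨a, ha, b, hb, rfl⟩ := lam_decomp y
  have h1 := lam_super (mem_odd h) ha
  have h2 := lam_super (mem_odd h) hb
  have h3 : inv (a + b) = a + -b := by
    rw [← inv_odd hb]; nth_rewrite 2 [← inv_even ha]; exact map_add _ _ _
  simp at h1 h2
  rw [h3, mul_add, add_mul, h1, h2, neg_mul]

theorem inv_inv' (x : SuperAlg N) : inv (inv x) = x := CliffordAlgebra.involute_involute x

theorem SmoothLam.ringInverse {f : LF N} (hf : SmoothLam f) (hu : ∀ x t, IsUnit (f x t)) :
    SmoothLam (fun x t => Ring.inverse (f x t)) := by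
  classical
  intro l
  let A : SuperAlg N →ₐ[ℝ] Matrix (Finset (Fin N)) (Finset (Fin N)) ℝ := Algebra.leftMulMatrix (bas N)
  letI : NormedRing (Matrix (Finset (Fin N)) (Finset (Fin N)) ℝ) := Matrix.linftyOpNormedRing
  letI : NormedAlgebra ℝ (Matrix (Finset (Fin N)) (Finset (Fin N)) ℝ) := Matrix.linftyOpNormedAlgebra
  have hA : ContDiff ℝ (⊤ : ℕ∞) (fun p : ℝ × ℝ => A (f p.1 p.2)) := by
    have he : (fun p : ℝ × ℝ => A (f p.1 p.2)) =
        fun p => ∑ i, (bas N).coord i (f p.1 p.2) • A (bas N i) := funext fun p => by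
      conv_lhs => rw [← (bas N).sum_repr (f p.1 p.2)]
      rw [map_sum]
      exact Finset.sum_congr rfl fun i _ => by rw [map_smul]; rfl
    rw [he]
    exact ContDiff.sum fun i _ => (hf _).smul contDiff_const
  have hAi : ContDiff ℝ (⊤ : ℕ∞) (fun p : ℝ × ℝ => Ring.inverse (A (f p.1 p.2))) := by
    rw [contDiff_iff_contDiffAt]
    intro p
    obtain ⟨v, hv⟩ := (hu p.1 p.2).map A
    have := contDiffAt_ringInverse ℝ (n := (⊤ : ℕ∞)) v
    rw [hv] at this
    exact this.comp p hA.contDiffAt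
  have hm : ∀ p : ℝ × ℝ, Ring.inverse (A (f p.1 p.2)) = A (Ring.inverse (f p.1 p.2)) := fun p => by
    obtain ⟨v, hv⟩ := hu p.1 p.2
    rw [← hv, Ring.inverse_unit]
    exact Ring.inverse_unit (Units.map (A : SuperAlg N →+* Matrix (Finset (Fin N)) (Finset (Fin N)) ℝ).toMonoidHom v)
  let Lm : Matrix (Finset (Fin N)) (Finset (Fin N)) ℝ →ₗ[ℝ] ℝ :=
    l ∘ₗ LinearMap.applyₗ (1 : SuperAlg N) ∘ₗ (Matrix.toLin (bas N) (bas N)).toLinearMap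
  have hl : ∀ v : SuperAlg N, l v = Lm (A v) := fun v => by
    simp [Lm, A, Algebra.leftMulMatrix_apply]
  have he : (fun p : ℝ × ℝ => l (Ring.inverse (f p.1 p.2))) =
      fun p => Lm.toContinuousLinearMap (Ring.inverse (A (f p.1 p.2))) := funext fun p => by
    rw [hl, hm]; rfl
  rw [he]
  exact Lm.toContinuousLinearMap.contDiff.comp hAi

end Analysis

section Concrete
variable {N : ℕ}

theorem inv_mul (x y : SuperAlg N) : inv (x * y) = inv x * inv y := map_mul _ _ _
theorem inv_add (x y : SuperAlg N) : inv (x + y) = inv x + inv y := map_add _ _ _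
theorem inv_neg' (x : SuperAlg N) : inv (-x) = -inv x := map_neg _ _
theorem inv_one' : inv (1 : SuperAlg N) = 1 := map_one _
theorem inv_zero' : inv (0 : SuperAlg N) = 0 := map_zero _
theorem inv_smul (r : ℝ) (x : SuperAlg N) : inv (r • x) = r • inv x :=
  map_smul (CliffordAlgebra.involute (Q := (0 : QuadraticForm ℝ (Fin N → ℝ)))) r x

def invL (N : ℕ) : SuperAlg N →ₗ[ℝ] SuperAlg N where
  toFun := inv
  map_add' := inv_add
  map_smul' := inv_smul

namespace SF

@[simp] theorem add_c0 (f g : SF N) (x t : ℝ) : (f + g).c0 x t = f.c0 x t + g.c0 x t := rfl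
@[simp] theorem add_c1 (f g : SF N) (x t : ℝ) : (f + g).c1 x t = f.c1 x t + g.c1 x t := rfl
@[simp] theorem neg_c0 (f : SF N) (x t : ℝ) : (-f).c0 x t = -f.c0 x t := rfl
@[simp] theorem neg_c1 (f : SF N) (x t : ℝ) : (-f).c1 x t = -f.c1 x t := rfl
@[simp] theorem smul_c0 (r : ℝ) (f : SF N) (x t : ℝ) : (r • f).c0 x t = r • f.c0 x t := rfl
@[simp] theorem smul_c1 (r : ℝ) (f : SF N) (x t : ℝ) : (r • f).c1 x t = r • f.c1 x t := rfl
@[simp] theorem mul_c0 (f g : SF N) (x t : ℝ) : (f * g).c0 x t = f.c0 x t * g.c0 x t := rfl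
@[simp] theorem mul_c1 (f g : SF N) (x t : ℝ) : (f * g).c1 x t =
    f.c1 x t * g.c0 x t + inv (f.c0 x t) * g.c1 x t := rfl
@[simp] theorem one_c0 (x t : ℝ) : (1 : SF N).c0 x t = 1 := rfl
@[simp] theorem one_c1 (x t : ℝ) : (1 : SF N).c1 x t = 0 := rfl
@[simp] theorem zero_c0 (x t : ℝ) : (0 : SF N).c0 x t = 0 := rfl
@[simp] theorem zero_c1 (x t : ℝ) : (0 : SF N).c1 x t = 0 := rfl

theorem ext2 {f g : SF N} (h0 : ∀ x t, f.c0 x t = g.c0 x t) (h1 : ∀ x t, f.c1 x t = g.c1 x t) :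
    f = g := SF.ext (funext fun x => funext (h0 x)) (funext fun x => funext (h1 x))

instance instRing : Ring (SF N) :=
  { (inferInstance : AddCommGroup (SF N)) with
    mul := (· * ·)
    one := 1
    mul_assoc := fun a b c => ext2 (fun x t => by simp [mul_assoc]) (fun x t => by
      simp [mul_assoc, inv_mul, mul_add, add_mul, add_assoc])
    one_mul := fun a => ext2 (fun x t => by simp) (fun x t => by simp [inv_one'])
    mul_one := fun a => ext2 (fun x t => by simp) (fun x t => by simp)
    zero_mul := fun a => ext2 (fun x t => by simp) (fun x t => by simp [inv_zero'])
    mul_zero := fun a => ext2 (fun x t => by simp) (fun x t => by simp)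
    left_distrib := fun a b c => ext2 (fun x t => by simp [mul_add]) (fun x t => by
      simp [mul_add]; abel)
    right_distrib := fun a b c => ext2 (fun x t => by simp [add_mul]) (fun x t => by
      simp [add_mul, inv_add]; abel) }

instance instModule : Module ℝ (SF N) where
  one_smul a := ext2 (fun x t => by simp) (fun x t => by simp)
  mul_smul r s a := ext2 (fun x t => by simp [mul_smul]) (fun x t => by simp [mul_smul])
  smul_zero r := ext2 (fun x t => by simp) (fun x t => by simp)
  smul_add r a b := ext2 (fun x t => by simp) (fun x t => by simp)
  add_smul r s a := ext2 (fun x t => by simp [add_smul]) (fun x t => by simp [add_smul])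
  zero_smul a := ext2 (fun x t => by simp) (fun x t => by simp)

instance instAlgebra : Algebra ℝ (SF N) := Algebra.ofModule
  (fun r a b => ext2 (fun x t => by simp) (fun x t => by simp [inv_smul]))
  (fun r a b => ext2 (fun x t => by simp) (fun x t => by simp))

theorem Smooth.add {f g : SF N} (hf : f.Smooth) (hg : g.Smooth) : (f + g).Smooth :=
  ⟨hf.1.add hg.1, hf.2.add hg.2⟩

theorem Smooth.mul {f g : SF N} (hf : f.Smooth) (hg : g.Smooth) : (f * g).Smooth :=
  ⟨hf.1.mul hg.1, (hf.2.mul hg.1).add ((hf.1.map (invL N)).mul hg.2)⟩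

theorem Smooth.smul {f : SF N} (r : ℝ) (hf : f.Smooth) : (r • f).Smooth :=
  ⟨hf.1.map (r • LinearMap.id), hf.2.map (r • LinearMap.id)⟩

theorem Smooth.one : (1 : SF N).Smooth := ⟨SmoothLam.const 1, SmoothLam.const 0⟩

theorem Smooth.D {f : SF N} (hf : f.Smooth) : f.Dsd.Smooth := ⟨hf.2, hf.1.dX⟩
theorem Smooth.T {f : SF N} (hf : f.Smooth) : f.dt.Smooth := ⟨hf.1.dT, hf.2.dT⟩

/-- The algebra of smooth superfields. -/
def SmoothAlg (N : ℕ) : Subalgebra ℝ (SF N) where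
  carrier := {f | f.Smooth}
  mul_mem' := Smooth.mul
  add_mem' := Smooth.add
  algebraMap_mem' r := by
    rw [Algebra.algebraMap_eq_smul_one]; exact Smooth.one.smul r

/-- The parity automorphism. -/
def sig (f : SF N) : SF N := ⟨fun x t => inv (f.c0 x t), fun x t => -inv (f.c1 x t)⟩

@[simp] theorem sig_c0 (f : SF N) (x t : ℝ) : (sig f).c0 x t = inv (f.c0 x t) := rfl
@[simp] theorem sig_c1 (f : SF N) (x t : ℝ) : (sig f).c1 x t = -inv (f.c1 x t) := rfl

theorem Smooth.sig {f : SF N} (hf : f.Smooth) : f.sig.Smooth :=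
  ⟨hf.1.map (invL N), hf.2.map (-invL N)⟩

def sigA (N : ℕ) : SmoothAlg N →ₐ[ℝ] SmoothAlg N :=
  AlgHom.ofLinearMap
    { toFun := fun f => ⟨f.1.sig, Smooth.sig f.2⟩
      map_add' := fun f g => Subtype.ext <| ext2 (fun x t => by simp [inv_add])
        (fun x t => by simp [inv_add]; abel)
      map_smul' := fun r f => Subtype.ext <| ext2 (fun x t => by simp [inv_smul])
        (fun x t => by simp [inv_smul]) }
    (Subtype.ext <| ext2 (fun x t => by simp [inv_one']) (fun x t => by simp [inv_zero']))
    (fun f g => Subtype.ext <| ext2 (fun x t => by simp [inv_mul])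
        (fun x t => by simp [inv_add, inv_mul]; abel))

theorem dX_smul (r : ℝ) {f : LF N} (hf : SmoothLam f) :
    dX (fun x t => r • f x t) = fun x t => r • dX f x t := by
  have := dX_map hf (r • LinearMap.id)
  simpa only [LinearMap.smul_apply, LinearMap.id_apply] using this

theorem dT_smul (r : ℝ) {f : LF N} (hf : SmoothLam f) :
    dT (fun x t => r • f x t) = fun x t => r • dT f x t := by
  have := dT_map hf (r • LinearMap.id)
  simpa only [LinearMap.smul_apply, LinearMap.id_apply] using this

theorem D_smul (r : ℝ) {f : SF N} (hf : f.Smooth) : (r • f).Dsd = r • f.Dsd :=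
  SF.ext rfl (dX_smul r hf.1)

theorem T_smul (r : ℝ) {f : SF N} (hf : f.Smooth) : (r • f).dt = r • f.dt :=
  SF.ext (dT_smul r hf.1) (dT_smul r hf.2)

def DA (N : ℕ) : SmoothAlg N →ₗ[ℝ] SmoothAlg N where
  toFun f := ⟨f.1.Dsd, Smooth.D f.2⟩
  map_add' f g := Subtype.ext <| SF.ext rfl (dX_add f.2.1 g.2.1)
  map_smul' r f := Subtype.ext <| D_smul r f.2

def TA (N : ℕ) : SmoothAlg N →ₗ[ℝ] SmoothAlg N where
  toFun f := ⟨f.1.dt, Smooth.T f.2⟩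
  map_add' f g := Subtype.ext <| SF.ext (dT_add f.2.1 g.2.1) (dT_add f.2.2 g.2.2)
  map_smul' r f := Subtype.ext <| T_smul r f.2

theorem sig_sig (f : SF N) : f.sig.sig = f :=
  ext2 (fun x t => by simp [inv_inv']) (fun x t => by simp [inv_inv', inv_neg'])

theorem sig_D {f : SF N} (hf : f.Smooth) : f.Dsd.sig = -f.sig.Dsd :=
  ext2 (fun x t => (neg_neg _).symm) (fun x t => by
    have := congrFun (congrFun (dX_map hf.1 (invL N)) x) t
    exact congrArg Neg.neg this.symm)

theorem sig_T {f : SF N} (hf : f.Smooth) : f.dt.sig = f.sig.dt :=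
  SF.ext (dT_map hf.1 (invL N)).symm (dT_map hf.2 (-invL N)).symm

theorem D_mul {f g : SF N} (hf : f.Smooth) (hg : g.Smooth) :
    (f * g).Dsd = f.Dsd * g + f.sig * g.Dsd :=
  ext2 (fun x t => rfl) (fun x t => by
    refine (congrFun (congrFun (dX_mul hf.1 hg.1) x) t).trans ?_
    change _ = (dX f.c0 x t * g.c0 x t + inv (f.c1 x t) * g.c1 x t) +
      (-inv (f.c1 x t) * g.c1 x t + inv (inv (f.c0 x t)) * dX g.c0 x t)
    rw [inv_inv', neg_mul]; abel)

theorem T_mul {f g : SF N} (hf : f.Smooth) (hg : g.Smooth) :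
    (f * g).dt = f.dt * g + f * g.dt :=
  ext2 (fun x t => (congrFun (congrFun (dT_mul hf.1 hg.1) x) t)) (fun x t => by
    refine (congrFun (congrFun (dT_add (hf.2.mul hg.1) ((hf.1.map (invL N)).mul hg.2)) x) t).trans ?_
    rw [dT_mul hf.2 hg.1, dT_mul (hf.1.map (invL N)) hg.2, dT_map hf.1 (invL N)]
    change (dT f.c1 x t * g.c0 x t + f.c1 x t * dT g.c0 x t) +
      (inv (dT f.c0 x t) * g.c1 x t + inv (f.c0 x t) * dT g.c1 x t) =
      (dT f.c1 x t * g.c0 x t + inv (dT f.c0 x t) * g.c1 x t) +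
      (f.c1 x t * dT g.c0 x t + inv (f.c0 x t) * dT g.c1 x t)
    abel)

theorem T_D {f : SF N} (hf : f.Smooth) : f.Dsd.dt = f.dt.Dsd := SF.ext rfl hf.1.comm

theorem sig_even {f : SF N} (h : f.IsEven) : f.sig = f :=
  ext2 (fun x t => inv_even (h.1 x t)) (fun x t => by simp [inv_odd (h.2 x t)])

theorem sig_odd {f : SF N} (h : f.IsOdd) : f.sig = -f :=
  ext2 (fun x t => inv_odd (h.1 x t)) (fun x t => by simp [inv_even (h.2 x t)])

theorem c0_of_sig {f g : SF N} (h : f.sig = g) (x t : ℝ) : inv (f.c0 x t) = g.c0 x t := by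
  rw [← h]; rfl
theorem c1_of_sig {f g : SF N} (h : f.sig = g) (x t : ℝ) : inv (f.c1 x t) = -g.c1 x t := by
  rw [← h]; simp

theorem ev {f : SF N} (h : f.sig = f) (g : SF N) : f * g = g * f :=
  ext2 (fun x t => even_comm (c0_of_sig h x t) _) (fun x t => by
    simp only [mul_c1]
    rw [c0_of_sig h, even_comm (c0_of_sig h x t), odd_comm (c1_of_sig h x t), add_comm])

theorem od {f g : SF N} (hf : f.sig = -f) (hg : g.sig = -g) : f * g = -(g * f) :=
  ext2 (fun x t => by
    have := odd_comm (c0_of_sig hf x t) (g.c0 x t)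
    rw [c0_of_sig hg] at this
    simpa using this) (fun x t => by
    have h1 : inv (f.c1 x t) = f.c1 x t := by rw [c1_of_sig hf]; simp
    have h2 : inv (g.c1 x t) = g.c1 x t := by rw [c1_of_sig hg]; simp
    simp only [mul_c1, neg_c1]
    rw [c0_of_sig hf, c0_of_sig hg, neg_c0, neg_c0, even_comm h1, even_comm h2]
    simp only [neg_mul]
    abel)

theorem smooth_sinv {f : SF N} (hf : f.Smooth) (hi : f.Invertible) : f.sinv.Smooth := by
  have h1 := hf.1.ringInverse hi
  have h2 : SmoothLam (fun x t => Ring.inverse (inv (f.c0 x t))) :=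
    (hf.1.map (invL N)).ringInverse fun x t => (hi x t).map
      (CliffordAlgebra.involute (Q := (0 : QuadraticForm ℝ (Fin N → ℝ))))
  exact ⟨h1, ((h2.mul hf.2).mul h1).map (-LinearMap.id)⟩

theorem mul_sinv {f : SF N} (hi : f.Invertible) : f * f.sinv = 1 :=
  ext2 (fun x t => Ring.mul_inverse_cancel _ (hi x t)) (fun x t => by
    have hu : IsUnit (inv (f.c0 x t)) := (hi x t).map
      (CliffordAlgebra.involute (Q := (0 : QuadraticForm ℝ (Fin N → ℝ))))
    change f.c1 x t * Ring.inverse (f.c0 x t) + inv (f.c0 x t) *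
      -(Ring.inverse (inv (f.c0 x t)) * f.c1 x t * Ring.inverse (f.c0 x t)) = 0
    rw [mul_neg, mul_assoc, ← mul_assoc (inv _), Ring.mul_inverse_cancel _ hu, one_mul,
      add_neg_cancel])

end SF
end Concrete

/-- the Darboux-transformed pair `(α̂, û)` again solves MRSKdV. -/
theorem statement_3 {N : ℕ} (hN : 1 ≤ N) (α u : SF N)
    (hαo : α.IsOdd) (hue : u.IsEven) (hαs : α.Smooth) (hus : u.Smooth)
    (hMR : MRSKdV α u)
    (lam₀ : ℝ) (θ₀ : SF N) (hθe : θ₀.IsEven) (hθi : θ₀.Invertible) (hθs : θ₀.Smooth)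
    (hθ : LinSys α u lam₀ θ₀) :
    MRSKdV (hatAlpha α θ₀) (hatU α u θ₀) := by
  let a : SF.SmoothAlg N := ⟨α, hαs⟩
  let v : SF.SmoothAlg N := ⟨u, hus⟩
  let θ : SF.SmoothAlg N := ⟨θ₀, hθs⟩
  let ι : SF.SmoothAlg N := ⟨θ₀.sinv, SF.smooth_sinv hθs hθi⟩
  have h := core2 (SF.DA N) (SF.TA N) (SF.sigA N)
    (fun y => Subtype.ext (SF.sig_sig y.1))
    (fun y => Subtype.ext (SF.sig_D y.2))
    (fun y => Subtype.ext (SF.sig_T y.2))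
    (fun x y => Subtype.ext (SF.D_mul x.2 y.2))
    (fun x y => Subtype.ext (SF.T_mul x.2 y.2))
    (fun y => Subtype.ext (SF.T_D y.2))
    (fun x hx y => Subtype.ext (SF.ev (congrArg Subtype.val hx) y.1))
    (fun x y hx hy => Subtype.ext (SF.od (congrArg Subtype.val hx) (congrArg Subtype.val hy)))
    a v θ ι _ lam₀
    (Subtype.ext (SF.sig_odd hαo)) (Subtype.ext (SF.sig_even hθe))
    (Subtype.ext (SF.mul_sinv hθi)) rfl
    (Subtype.ext hMR.1) (Subtype.ext hθ.1) (Subtype.ext hθ.2) _ _ rfl rfl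
  exact ⟨congrArg Subtype.val h.1, congrArg Subtype.val h.2⟩
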